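/- A vector (f*_0, …, f*_d) is the f*-vector of some integral partial polytopal complex if and only if all its entries are non-negative integers. -/

import Mathlib

open Polynomial Pointwise

/-- The polynomial `binomial (k-1) i` in the variable `k`. -/
noncomputable def binomDesc (i : ℕ) : Polynomial ℚ :=
  C ((i.factorial : ℚ)⁻¹) * ∏ j ∈ Finset.range i, (X - C ((j : ℚ) + 1))

/-- The relatively open lattice polytope with vertex set `V ⊆ ℤ^n`. -/
noncomputable def openLatticePolytope (n : ℕ) (V : Finset (Fin n → ℤ)) :
    Set (Fin n → ℝ) :=
  intrinsicInterior ℝ (convexHull ℝ ((fun z : Fin n → ℤ => fun j => ((z j : ℝ))) '' V))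

section PosHull

/-- The strictly positive convex combinations of a finite family of points. -/
def posHull {ι E : Type*} [Fintype ι] [AddCommGroup E] [Module ℝ E] (v : ι → E) : Set E :=
  {x | ∃ w : ι → ℝ, (∀ i, 0 < w i) ∧ ∑ i, w i = 1 ∧ ∑ i, w i • v i = x}

variable {ι E : Type*} [Fintype ι] [NormedAddCommGroup E] [NormedSpace ℝ E]

theorem mem_convexHull_range_iff_exists_weights {v : ι → E} {x : E} :
    x ∈ convexHull ℝ (Set.range v) ↔
      ∃ w : ι → ℝ, (∀ i, 0 ≤ w i) ∧ ∑ i, w i = 1 ∧ ∑ i, w i • v i = x := by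
  classical
  constructor
  · rw [convexHull_range_eq_exists_affineCombination]
    rintro ⟨s, w, hw0, hw1, rfl⟩
    refine ⟨fun i => if i ∈ s then w i else 0, fun i => ?_, ?_, ?_⟩
    · dsimp only
      split_ifs with h
      exacts [hw0 i h, le_rfl]
    · simpa using hw1
    · rw [s.affineCombination_eq_linear_combination v w hw1]
      simp [ite_smul]
  · rintro ⟨w, hw0, hw1, rfl⟩
    exact (convex_convexHull ℝ _).sum_mem (fun i _ => hw0 i) hw1
      fun i _ => subset_convexHull ℝ _ ⟨i, rfl⟩

/-- A vector that is non-negative wherever the non-negative vector `w` vanishes can be added to `w`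
with a small positive coefficient without losing non-negativity. -/
theorem exists_pos_forall_add_mul_nonneg {w δ : ι → ℝ} (hw : ∀ i, 0 ≤ w i)
    (hδ : ∀ i, w i = 0 → 0 ≤ δ i) : ∃ ε : ℝ, 0 < ε ∧ ∀ i, 0 ≤ w i + ε * δ i := by
  have key : ∀ᶠ ε : ℝ in nhdsWithin 0 (Set.Ioi 0), ∀ i, 0 ≤ w i + ε * δ i := by
    rw [Filter.eventually_all]
    intro i
    rcases (hw i).eq_or_lt with h | h
    · filter_upwards [self_mem_nhdsWithin] with ε hε
      rw [← h, zero_add]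
      exact mul_nonneg (le_of_lt hε) (hδ i h.symm)
    · have hc : ContinuousAt (fun ε : ℝ => w i + ε * δ i) 0 := by fun_prop
      have := hc.eventually (lt_mem_nhds (a := 0) (by simpa using h))
      filter_upwards [nhdsWithin_le_nhds this] with ε hε using hε.le
  obtain ⟨ε, h, hε⟩ := (key.and self_mem_nhdsWithin).exists
  exact ⟨ε, hε, h⟩

theorem mem_intrinsicInterior_iff_exists_ball {s : Set E} {x : E} :
    x ∈ intrinsicInterior ℝ s ↔ x ∈ affineSpan ℝ s ∧
      ∃ ε > 0, ∀ y ∈ affineSpan ℝ s, dist y x < ε → y ∈ s := by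
  rw [mem_intrinsicInterior]
  constructor
  · rintro ⟨y, hy, rfl⟩
    rw [mem_interior_iff_mem_nhds, Metric.mem_nhds_iff] at hy
    obtain ⟨ε, hε, h⟩ := hy
    exact ⟨y.2, ε, hε, fun z hz hd => h (show (⟨z, hz⟩ : affineSpan ℝ s) ∈ Metric.ball y ε from hd)⟩
  · rintro ⟨hx, ε, hε, h⟩
    refine ⟨⟨x, hx⟩, ?_, rfl⟩
    rw [mem_interior_iff_mem_nhds, Metric.mem_nhds_iff]
    exact ⟨ε, hε, fun z hz => h z z.2 hz⟩

/-- The relative interior of a polytope consists of the strictly positive convex combinations of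
any finite family of points spanning it. -/
theorem intrinsicInterior_convexHull_range [FiniteDimensional ℝ E] (v : ι → E) :
    intrinsicInterior ℝ (convexHull ℝ (Set.range v)) = posHull v := by
  classical
  rcases isEmpty_or_nonempty ι with hι | hι
  · ext x
    simp [posHull, Set.range_eq_empty]
  ext x
  constructor
  · intro hx
    obtain ⟨hxs, ε, hε, h⟩ := mem_intrinsicInterior_iff_exists_ball.1 hx
    have hN : (0 : ℝ) < Fintype.card ι := by exact_mod_cast Fintype.card_pos
    set c : E := ∑ i, (Fintype.card ι : ℝ)⁻¹ • v i with hc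
    have hcm : c ∈ convexHull ℝ (Set.range v) :=
      mem_convexHull_range_iff_exists_weights.2
        ⟨fun _ => (Fintype.card ι : ℝ)⁻¹, fun _ => by positivity, by simp [hN.ne'], rfl⟩
    set t : ℝ := ε / (2 * (dist x c + 1)) with ht
    have hd : 0 ≤ dist x c := dist_nonneg
    have ht0 : 0 < t := by positivity
    have hy : AffineMap.lineMap c x (1 + t) ∈ convexHull ℝ (Set.range v) := by
      refine h _ (AffineMap.lineMap_mem _ (subset_affineSpan ℝ _ hcm) hxs) ?_
      rw [dist_lineMap_right, Real.norm_eq_abs, dist_comm c x]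
      have : |1 - (1 + t)| = t := by
        rw [show 1 - (1 + t) = -t by ring, abs_neg, abs_of_pos ht0]
      rw [this, ht, div_mul_eq_mul_div, div_lt_iff₀ (by positivity)]
      nlinarith
    obtain ⟨w, hw0, hw1, hwy⟩ := mem_convexHull_range_iff_exists_weights.1 hy
    refine ⟨fun i => (1 + t)⁻¹ * (w i + t * (Fintype.card ι : ℝ)⁻¹), fun i => ?_, ?_, ?_⟩
    · have := hw0 i
      positivity
    · rw [← Finset.mul_sum, Finset.sum_add_distrib, hw1]
      simp only [Finset.sum_const, Finset.card_univ, nsmul_eq_mul]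
      field_simp
    · simp_rw [mul_smul, ← Finset.smul_sum, add_smul, Finset.sum_add_distrib, mul_smul,
        ← Finset.smul_sum]
      rw [Finset.smul_sum, ← hc, hwy, AffineMap.lineMap_apply_module]
      rw [inv_smul_eq_iff₀ (by positivity)]
      module
  · rintro ⟨w, hw0, hw1, rfl⟩
    obtain ⟨p, hp⟩ := Set.Nonempty.intrinsicInterior (convex_convexHull ℝ (Set.range v))
      (convexHull_nonempty_iff.2 (Set.range_nonempty v))
    obtain ⟨u, hu0, hu1, hup⟩ := mem_convexHull_range_iff_exists_weights.1
      (intrinsicInterior_subset hp)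
    obtain ⟨hps, ε, hε, h⟩ := mem_intrinsicInterior_iff_exists_ball.1 hp
    obtain ⟨r, hr, hwr⟩ := exists_pos_forall_add_mul_nonneg (w := w) (δ := fun i => w i - u i)
      (fun i => (hw0 i).le) (fun i hi => absurd hi (hw0 i).ne')
    set x := ∑ i, w i • v i with hx
    -- `q` lies beyond `x` on the ray from `p`
    set q := x + r • (x - p) with hq
    have hqm : q ∈ convexHull ℝ (Set.range v) := by
      refine mem_convexHull_range_iff_exists_weights.2 ⟨_, hwr, ?_, ?_⟩
      · rw [Finset.sum_add_distrib, ← Finset.mul_sum, Finset.sum_sub_distrib, hw1, hu1]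
        ring
      · simp_rw [add_smul, mul_smul, sub_smul, Finset.sum_add_distrib, ← Finset.smul_sum,
          Finset.sum_sub_distrib, hup, ← hx, hq]
    have hxm : x ∈ convexHull ℝ (Set.range v) :=
      mem_convexHull_range_iff_exists_weights.2 ⟨w, fun i => (hw0 i).le, hw1, rfl⟩
    refine mem_intrinsicInterior_iff_exists_ball.2
      ⟨subset_affineSpan ℝ _ hxm, r / (1 + r) * ε, by positivity, fun y hy hyx => ?_⟩
    have hz : AffineMap.lineMap q y ((1 + r) / r) ∈ convexHull ℝ (Set.range v) := by
      refine h _ (AffineMap.lineMap_mem _ (subset_affineSpan ℝ _ hqm) hy) ?_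
      have : AffineMap.lineMap q y ((1 + r) / r) - p = ((1 + r) / r) • (y - x) := by
        rw [AffineMap.lineMap_apply_module, hq]
        match_scalars <;> field_simp <;> ring
      rw [dist_eq_norm, this, norm_smul, ← dist_eq_norm, Real.norm_of_nonneg (by positivity)]
      calc (1 + r) / r * dist y x < (1 + r) / r * (r / (1 + r) * ε) := by gcongr
        _ = ε := by field_simp
    have hyz : y = (1 + r)⁻¹ • q + (r / (1 + r)) • AffineMap.lineMap q y ((1 + r) / r) := by
      rw [AffineMap.lineMap_apply_module]
      match_scalars <;> field_simp <;> ring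
    rw [hyz]
    exact convex_convexHull ℝ _ hqm hz (by positivity) (by positivity) (by field_simp)

end PosHull

section Triangulation

variable {ι E : Type*} [Fintype ι] [NormedAddCommGroup E] [NormedSpace ℝ E]

theorem mem_posHull_subtype_iff {v : ι → E} {S : Finset ι} {x : E} :
    x ∈ posHull (fun i : S => v i) ↔ ∃ w : ι → ℝ, (∀ i, 0 ≤ w i) ∧ (∀ i, i ∈ S ↔ w i ≠ 0) ∧
      ∑ i, w i = 1 ∧ ∑ i, w i • v i = x := by
  classical
  constructor
  · rintro ⟨w, hw0, hw1, rfl⟩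
    refine ⟨fun i => if h : i ∈ S then w ⟨i, h⟩ else 0, fun i => ?_, fun i => ?_, ?_, ?_⟩
    · dsimp only
      split_ifs with h
      exacts [(hw0 _).le, le_rfl]
    · by_cases h : i ∈ S
      · simp [h, (hw0 ⟨i, h⟩).ne']
      · simp [h]
    · rw [← hw1, ← Finset.sum_subset (Finset.subset_univ S) (fun i _ h => by simp [h]),
        ← Finset.sum_coe_sort S]
      simp
    · rw [← Finset.sum_subset (Finset.subset_univ S) (fun i _ h => by simp [h]),
        ← Finset.sum_coe_sort S]
      simp
  · rintro ⟨w, hw0, hwS, hw1, rfl⟩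
    have h0 : ∀ i, i ∉ S → w i = 0 := fun i hi => by
      by_contra h
      exact hi ((hwS i).2 h)
    refine ⟨fun i => w i, fun i => (hw0 i).lt_of_ne' ((hwS i).1 i.2), ?_, ?_⟩
    · rw [Finset.sum_coe_sort S w, Finset.sum_subset (Finset.subset_univ S) (fun i _ h => h0 i h),
        hw1]
    · rw [Finset.sum_coe_sort S (fun i => w i • v i),
        Finset.sum_subset (Finset.subset_univ S) (fun i _ h => by simp [h0 i h])]

/-- The ways of writing `x` as a convex combination of the points `v i`. -/
def convexWeights (v : ι → E) (x : E) : Set (ι → ℝ) :=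
  {w | (∀ i, 0 ≤ w i) ∧ ∑ i, w i = 1 ∧ ∑ i, w i • v i = x}

/-- An affine dependency among the points `v i`. -/
def IsAffineDependency (v : ι → E) (δ : ι → ℝ) : Prop :=
  ∑ i, δ i = 0 ∧ ∑ i, δ i • v i = 0

theorem IsAffineDependency.neg {v : ι → E} {δ : ι → ℝ} (h : IsAffineDependency v δ) :
    IsAffineDependency v (-δ) := by
  simpa [IsAffineDependency, neg_smul] using h

theorem isAffineDependency_sub {v : ι → E} {x : E} {w w' : ι → ℝ} (hw : w ∈ convexWeights v x)
    (hw' : w' ∈ convexWeights v x) : IsAffineDependency v (w' - w) := by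
  simp [IsAffineDependency, sub_smul, hw.2.1, hw.2.2, hw'.2.1, hw'.2.2]

theorem add_smul_mem_convexWeights {v : ι → E} {x : E} {w δ : ι → ℝ}
    (hw : w ∈ convexWeights v x) (hδ : IsAffineDependency v δ) {ε : ℝ}
    (h : ∀ i, 0 ≤ w i + ε * δ i) : w + ε • δ ∈ convexWeights v x := by
  refine ⟨h, ?_, ?_⟩
  · simp [Finset.sum_add_distrib, ← Finset.mul_sum, hw.2.1, hδ.1]
  · simp [Finset.sum_add_distrib, add_smul, mul_smul, ← Finset.smul_sum, hw.2.2, hδ.2]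

theorem isCompact_convexWeights (v : ι → E) (x : E) : IsCompact (convexWeights v x) := by
  have h : convexWeights v x = stdSimplex ℝ ι ∩ {w | ∑ i, w i • v i = x} := by
    ext w
    simp [convexWeights, stdSimplex, and_assoc]
  rw [h]
  exact (isCompact_stdSimplex ℝ ι).inter_right
    (isClosed_eq (by fun_prop) continuous_const)

/-- `c` is generic for `v` if it is non-zero on some dependency of every affinely dependent
subfamily. -/
def IsGenericFor (v : ι → E) (c : Module.Dual ℝ (ι → ℝ)) : Prop :=
  ∀ S : Finset ι, ¬ AffineIndependent ℝ (fun i : S => v i) →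
    ∃ δ, IsAffineDependency v δ ∧ (∀ i, i ∉ S → δ i = 0) ∧ c δ ≠ 0

open Classical in
theorem sum_extend_by_zero {F : Type*} [AddCommMonoid F] {S : Finset ι} (s : Finset S) (w : S → ℝ)
    (g : ι → ℝ → F) (hg : ∀ i, g i 0 = 0) :
    ∑ i, g i (if h : ∃ hi : i ∈ S, (⟨i, hi⟩ : S) ∈ s then w ⟨i, h.1⟩ else 0) =
      ∑ i ∈ s, g i (w i) := by
  rw [← Finset.sum_subset (Finset.subset_univ (s.map (Function.Embedding.subtype _))),
    Finset.sum_map]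
  · refine Finset.sum_congr rfl fun i hi => ?_
    simp [hi]
  · intro i _ hi
    rw [dif_neg, hg]
    simpa using hi

theorem exists_isAffineDependency_of_not_affineIndependent {v : ι → E} {S : Finset ι}
    (h : ¬ AffineIndependent ℝ (fun i : S => v i)) :
    ∃ δ, IsAffineDependency v δ ∧ (∀ i, i ∉ S → δ i = 0) ∧ δ ≠ 0 := by
  classical
  rw [affineIndependent_iff] at h
  push Not at h
  obtain ⟨s, w, hw1, hwv, e, hes, he⟩ := h
  refine ⟨_, ⟨(sum_extend_by_zero s w (fun _ a => a) fun _ => rfl).trans hw1,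
    (sum_extend_by_zero s w (fun i a => a • v i) fun i => zero_smul _ _).trans hwv⟩,
    fun i hi => by simp [hi], fun h0 => he ?_⟩
  simpa [hes] using congrFun h0 e

theorem exists_isGenericFor (v : ι → E) : ∃ c, IsGenericFor v c := by
  have h : ∀ S : {S : Finset ι // ¬ AffineIndependent ℝ (fun i : S => v i)},
      ∃ δ, IsAffineDependency v δ ∧ (∀ i, i ∉ S.1 → δ i = 0) ∧ δ ≠ 0 :=
    fun S => exists_isAffineDependency_of_not_affineIndependent S.2
  choose δ h1 h2 h3 using h
  obtain ⟨c, hc⟩ := Module.exists_dual_forall_apply_ne_zero (K := ℝ) δ h3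
  exact ⟨c, fun S hS => ⟨δ ⟨S, hS⟩, h1 ⟨S, hS⟩, h2 ⟨S, hS⟩, hc ⟨S, hS⟩⟩⟩

/-- `w` maximizes `c` among all ways of writing `x` as a convex combination. -/
def IsMaxWeight (v : ι → E) (c : Module.Dual ℝ (ι → ℝ)) (x : E) (w : ι → ℝ) : Prop :=
  w ∈ convexWeights v x ∧ ∀ w' ∈ convexWeights v x, c w' ≤ c w

variable {v : ι → E} {c : Module.Dual ℝ (ι → ℝ)} {x y : E} {w w' : ι → ℝ}

theorem exists_isMaxWeight (c : Module.Dual ℝ (ι → ℝ)) (hw : w ∈ convexWeights v x) :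
    ∃ u, IsMaxWeight v c x u := by
  obtain ⟨u, hu, hmax⟩ := (isCompact_convexWeights v x).exists_isMaxOn ⟨w, hw⟩
    (f := c) c.continuous_of_finiteDimensional.continuousOn
  exact ⟨u, hu, fun w' hw' => hmax hw'⟩

theorem IsMaxWeight.apply_dependency_nonpos (hw : IsMaxWeight v c x w) {δ : ι → ℝ}
    (hδ : IsAffineDependency v δ) (h0 : ∀ i, w i = 0 → 0 ≤ δ i) : c δ ≤ 0 := by
  obtain ⟨ε, hε, h⟩ := exists_pos_forall_add_mul_nonneg hw.1.1 h0
  have := hw.2 _ (add_smul_mem_convexWeights hw.1 hδ h)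
  rw [map_add, map_smul, smul_eq_mul] at this
  nlinarith

theorem IsMaxWeight.affineIndependent (hc : IsGenericFor v c) (hw : IsMaxWeight v c x w)
    {S : Finset ι} (hS : ∀ i, w i = 0 → i ∉ S) : AffineIndependent ℝ (fun i : S => v i) := by
  by_contra h
  obtain ⟨δ, hδ, h0, hne⟩ := hc S h
  have h1 := hw.apply_dependency_nonpos hδ fun i hi => (h0 i (hS i hi)).ge
  have h2 := hw.apply_dependency_nonpos hδ.neg fun i hi => by simp [h0 i (hS i hi)]
  rw [map_neg] at h2
  exact hne (by linarith)

theorem IsMaxWeight.unique (hc : IsGenericFor v c) (hw : IsMaxWeight v c x w)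
    (hw' : IsMaxWeight v c x w') : w = w' := by
  classical
  have hmid : IsMaxWeight v c x ((1 / 2 : ℝ) • w + (1 / 2 : ℝ) • w') := by
    refine ⟨⟨fun i => ?_, ?_, ?_⟩, fun u hu => ?_⟩
    · have h1 := hw.1.1 i
      have h2 := hw'.1.1 i
      simp only [Pi.add_apply, Pi.smul_apply, smul_eq_mul]
      positivity
    · simp [Finset.sum_add_distrib, ← Finset.mul_sum, hw.1.2.1, hw'.1.2.1]
      norm_num
    · simp only [Pi.add_apply, Pi.smul_apply, smul_eq_mul, add_smul, mul_smul,
        Finset.sum_add_distrib, ← Finset.smul_sum, hw.1.2.2, hw'.1.2.2]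
      module
    · have h1 := hw.2 u hu
      have h2 := hw'.2 u hu
      simp only [map_add, map_smul, smul_eq_mul]
      linarith
  have hzero : ∀ i, ((1 / 2 : ℝ) • w + (1 / 2 : ℝ) • w') i = 0 → w i = 0 ∧ w' i = 0 := by
    intro i hi
    have h1 := hw.1.1 i
    have h2 := hw'.1.1 i
    simp only [Pi.add_apply, Pi.smul_apply, smul_eq_mul] at hi
    constructor <;> linarith
  have hind := hmid.affineIndependent hc
    (S := Finset.univ.filter fun i => ¬ (w i = 0 ∧ w' i = 0)) (by simpa using hzero)
  rw [affineIndependent_iff] at hind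
  have hdep := isAffineDependency_sub hw.1 hw'.1
  set S := Finset.univ.filter fun i => ¬ (w i = 0 ∧ w' i = 0) with hS
  have h0 : ∀ i, i ∉ S → (w' - w) i = 0 := fun i hi => by
    have : w i = 0 ∧ w' i = 0 := by simpa [hS] using hi
    simp [this.1, this.2]
  have key := hind Finset.univ (fun i => (w' - w) i)
    (by
      rw [Finset.sum_coe_sort S (w' - w),
        Finset.sum_subset (Finset.subset_univ S) fun i _ h => h0 i h]
      exact hdep.1)
    (by
      rw [Finset.sum_coe_sort S fun i => (w' - w) i • v i,
        Finset.sum_subset (Finset.subset_univ S) fun i _ h => by rw [h0 i h, zero_smul]]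
      exact hdep.2)
  ext i
  by_cases hi : i ∈ S
  · have := key ⟨i, hi⟩ (Finset.mem_univ _)
    simp only [Pi.sub_apply] at this
    linarith
  · have := h0 i hi
    simp only [Pi.sub_apply] at this
    linarith

/-- Whether weights are maximal only depends on their support. -/
theorem IsMaxWeight.of_support (hw : IsMaxWeight v c x w) (hw' : w' ∈ convexWeights v y)
    (h : ∀ i, w i = 0 → w' i = 0) : IsMaxWeight v c y w' := by
  refine ⟨hw', fun u hu => ?_⟩
  have := hw.apply_dependency_nonpos (isAffineDependency_sub hw' hu) fun i hi => by
    simpa [h i hi] using hu.1 i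
  rw [map_sub] at this
  linarith

/-- Every relatively open polytope is a disjoint union of relatively open simplices whose vertices
are among the given generators. -/
theorem exists_triangulation_posHull (v : ι → E) : ∃ T : Finset (Finset ι),
    (∀ S ∈ T, S.Nonempty ∧ AffineIndependent ℝ (fun i : S => v i)) ∧
    (∀ S ∈ T, ∀ S' ∈ T, S ≠ S' →
      Disjoint (posHull fun i : S => v i) (posHull fun i : S' => v i)) ∧
    posHull v = ⋃ S : T, posHull fun i : S.1 => v i := by
  classical
  obtain ⟨c, hc⟩ := exists_isGenericFor v
  refine ⟨Finset.univ.filter fun S => ∃ x ∈ posHull v, ∃ w, IsMaxWeight v c x w ∧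
    ∀ i, i ∈ S ↔ w i ≠ 0, ?_, ?_, ?_⟩
  · intro S hS
    obtain ⟨x, -, w, hw, hwS⟩ := (Finset.mem_filter.1 hS).2
    refine ⟨?_, hw.affineIndependent hc fun i hi hiS => (hwS i).1 hiS hi⟩
    by_contra hne
    rw [Finset.not_nonempty_iff_eq_empty] at hne
    have h0 : ∀ i, w i = 0 := fun i => by simpa [hne] using hwS i
    simpa [h0] using hw.1.2.1
  · intro S hS S' hS' hne
    obtain ⟨x, -, w, hw, hwS⟩ := (Finset.mem_filter.1 hS).2
    obtain ⟨x', -, w', hw', hwS'⟩ := (Finset.mem_filter.1 hS').2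
    rw [Set.disjoint_left]
    intro y hy hy'
    obtain ⟨u, hu0, huS, hu1, huy⟩ := mem_posHull_subtype_iff.1 hy
    obtain ⟨u', hu0', huS', hu1', huy'⟩ := mem_posHull_subtype_iff.1 hy'
    have h1 : IsMaxWeight v c y u := hw.of_support ⟨hu0, hu1, huy⟩ fun i hi => by
      have := (hwS i).symm.trans (huS i)
      tauto
    have h2 : IsMaxWeight v c y u' := hw'.of_support ⟨hu0', hu1', huy'⟩ fun i hi => by
      have := (hwS' i).symm.trans (huS' i)
      tauto
    have h3 := h1.unique hc h2
    subst h3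
    exact hne (Finset.ext fun i => (huS i).trans (huS' i).symm)
  · ext y
    simp only [Set.mem_iUnion]
    constructor
    · intro hy
      obtain ⟨u, hu0, hu1, huy⟩ := id hy
      obtain ⟨w, hw⟩ := exists_isMaxWeight c (v := v) (x := y) (w := u)
        ⟨fun i => (hu0 i).le, hu1, huy⟩
      have hmem : ∀ i, i ∈ Finset.univ.filter (fun i => w i ≠ 0) ↔ w i ≠ 0 := by simp
      exact ⟨⟨_, Finset.mem_filter.2 ⟨Finset.mem_univ _, y, hy, w, hw, hmem⟩⟩,
        mem_posHull_subtype_iff.2 ⟨w, hw.1.1, hmem, hw.1.2⟩⟩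
    · rintro ⟨⟨S, hS⟩, hy⟩
      obtain ⟨x, ⟨u, hu0, hu1, hux⟩, w, hw, hwS⟩ := (Finset.mem_filter.1 hS).2
      obtain ⟨m, hm0, hmS, hm1, hmy⟩ := mem_posHull_subtype_iff.1 hy
      obtain ⟨ε, hε, h⟩ := exists_pos_forall_add_mul_nonneg hm0 (δ := -w) fun i hi => by
        have := (hwS i).symm.trans (hmS i)
        have hwi : w i = 0 := by tauto
        simp [hwi]
      refine ⟨fun i => m i + ε * (u i - w i), fun i => ?_, ?_, ?_⟩
      · have h1 := h i
        have h2 := mul_pos hε (hu0 i)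
        simp only [Pi.neg_apply] at h1
        linarith
      · rw [Finset.sum_add_distrib, ← Finset.mul_sum, Finset.sum_sub_distrib, hm1, hu1, hw.1.2.1]
        ring
      · simp_rw [add_smul, mul_smul, sub_smul, Finset.sum_add_distrib, ← Finset.smul_sum,
          Finset.sum_sub_distrib, hmy, hux, hw.1.2.2]
        simp

end Triangulation

section LatticeCount

variable {ι : Type*} [Fintype ι] {n : ℕ}

/-- The inclusion of the lattice `ℤ^n` into `ℝ^n`. -/
def latticeCast (z : Fin n → ℤ) : Fin n → ℝ := fun j => (z j : ℝ)

theorem latticeCast_injective : Function.Injective (latticeCast (n := n)) := fun _ _ h =>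
  funext fun j => Int.cast_injective (α := ℝ) (congrFun h j)

/-- The lattice points in the `k`-th dilate of a set. -/
def latticePoints (A : Set (Fin n → ℝ)) (k : ℕ) : Set (Fin n → ℤ) :=
  {z | latticeCast z ∈ (k : ℝ) • A}

/-- The positive weights of total `k` on the family `v` whose combination is a lattice point. -/
def latticeWeights (v : ι → Fin n → ℤ) (k : ℕ) : Set (ι → ℝ) :=
  {w | (∀ i, 0 < w i) ∧ ∑ i, w i = k ∧ ∃ z, ∑ i, w i • latticeCast (v i) = latticeCast z}

theorem image_latticePoints_posHull (v : ι → Fin n → ℤ) {k : ℕ} (hk : 1 ≤ k) :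
    latticeCast '' latticePoints (posHull fun i => latticeCast (v i)) k =
      (fun w : ι → ℝ => ∑ i, w i • latticeCast (v i)) '' latticeWeights v k := by
  have hk0 : (k : ℝ) ≠ 0 := by positivity
  have hk1 : (0 : ℝ) < k := by positivity
  ext x
  constructor
  · rintro ⟨z, ⟨y, ⟨w, hw0, hw1, rfl⟩, hz⟩, rfl⟩
    have h : ∑ i, (k * w i) • latticeCast (v i) = latticeCast z := by
      simp only [mul_smul, ← Finset.smul_sum]
      exact hz
    exact ⟨fun i => k * w i, ⟨fun i => mul_pos hk1 (hw0 i),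
      by rw [← Finset.mul_sum, hw1, mul_one], z, h⟩, h⟩
  · rintro ⟨w, ⟨hw0, hw1, z, hz⟩, rfl⟩
    refine ⟨z, (Set.mem_smul_set_iff_inv_smul_mem₀ hk0 _ _).2 ⟨fun i => (k : ℝ)⁻¹ * w i,
      fun i => mul_pos (inv_pos.2 hk1) (hw0 i), ?_, ?_⟩, hz.symm⟩
    · rw [← Finset.mul_sum, hw1, inv_mul_cancel₀ hk0]
    · simp only [mul_smul, ← Finset.smul_sum, hz]

theorem finite_latticePoints_posHull (v : ι → Fin n → ℤ) {k : ℕ} (hk : 1 ≤ k) :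
    (latticePoints (posHull fun i => latticeCast (v i)) k).Finite := by
  refine (Set.finite_Icc (fun j => -(k * ∑ i, |v i j|)) fun j => k * ∑ i, |v i j|).subset
    fun z hz => ?_
  have hmem : latticeCast z ∈ (fun w : ι → ℝ => ∑ i, w i • latticeCast (v i)) ''
      latticeWeights v k := by
    rw [← image_latticePoints_posHull v hk]
    exact ⟨z, hz, rfl⟩
  obtain ⟨w, ⟨hw0, hw1, -⟩, hwz⟩ := hmem
  have hwk : ∀ i, w i ≤ k := fun i => by
    rw [← hw1]
    exact Finset.single_le_sum (fun i _ => (hw0 i).le) (Finset.mem_univ i)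
  have h : ∀ j, |z j| ≤ k * ∑ i, |v i j| := fun j => by
    have hj : ∑ i, w i * (v i j : ℝ) = z j := by
      have := congrFun hwz j
      simpa [latticeCast, Finset.sum_apply] using this
    have : |(z j : ℝ)| ≤ k * ∑ i, |(v i j : ℝ)| := by
      rw [← hj, Finset.mul_sum]
      refine (Finset.abs_sum_le_sum_abs _ _).trans (Finset.sum_le_sum fun i _ => ?_)
      rw [abs_mul, abs_of_pos (hw0 i)]
      exact mul_le_mul_of_nonneg_right (hwk i) (abs_nonneg _)
    exact_mod_cast this
  exact ⟨fun j => (abs_le.1 (h j)).1, fun j => (abs_le.1 (h j)).2⟩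

theorem injOn_latticeWeights {v : ι → Fin n → ℤ}
    (hv : AffineIndependent ℝ fun i => latticeCast (v i)) (k : ℕ) :
    Set.InjOn (fun w : ι → ℝ => ∑ i, w i • latticeCast (v i)) (latticeWeights v k) := by
  rintro w ⟨-, hw, -⟩ w' ⟨-, hw', -⟩ h
  rw [affineIndependent_iff] at hv
  ext i
  have := hv Finset.univ (w - w') (by simp [hw, hw'])
    (by simpa [sub_smul, sub_eq_zero] using h) i (Finset.mem_univ i)
  simpa [sub_eq_zero] using this

theorem finite_latticeWeights {v : ι → Fin n → ℤ}
    (hv : AffineIndependent ℝ fun i => latticeCast (v i)) {k : ℕ} (hk : 1 ≤ k) :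
    (latticeWeights v k).Finite := by
  refine Set.Finite.of_finite_image ?_ (injOn_latticeWeights hv k)
  rw [← image_latticePoints_posHull v hk]
  exact (finite_latticePoints_posHull v hk).image _

theorem ncard_latticePoints_eq_ncard_latticeWeights {v : ι → Fin n → ℤ}
    (hv : AffineIndependent ℝ fun i => latticeCast (v i)) {k : ℕ} (hk : 1 ≤ k) :
    (latticePoints (posHull fun i => latticeCast (v i)) k).ncard =
      (latticeWeights v k).ncard := by
  rw [← Set.ncard_image_of_injective _ latticeCast_injective, image_latticePoints_posHull v hk,
    (injOn_latticeWeights hv k).ncard_image]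

/-- The weights of the lattice points in the half-open fundamental box of the cone over `v`. -/
def boxWeights (v : ι → Fin n → ℤ) : Set (ι → ℝ) :=
  {b | (∀ i, b i ≤ 1) ∧ ∃ h : ℕ, b ∈ latticeWeights v h}

theorem floor_sum_of_mem_latticeWeights {v : ι → Fin n → ℤ} {b : ι → ℝ} {h : ℕ}
    (hb : b ∈ latticeWeights v h) : ⌊∑ i, b i⌋₊ = h := by
  rw [hb.2.1, Nat.floor_natCast]

theorem height_bounds [Nonempty ι] {v : ι → Fin n → ℤ} {b : ι → ℝ} {h : ℕ}
    (hb1 : ∀ i, b i ≤ 1) (hb : b ∈ latticeWeights v h) : 1 ≤ h ∧ h ≤ Fintype.card ι := by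
  constructor
  · have : (0 : ℝ) < h := by
      rw [← hb.2.1]
      exact Finset.sum_pos (fun i _ => hb.1 i) Finset.univ_nonempty
    exact_mod_cast this
  · have : (h : ℝ) ≤ Fintype.card ι := by
      rw [← hb.2.1]
      exact (Finset.sum_le_sum fun i _ => hb1 i).trans (by simp)
    exact_mod_cast this

theorem finite_boxWeights [Nonempty ι] {v : ι → Fin n → ℤ}
    (hv : AffineIndependent ℝ fun i => latticeCast (v i)) : (boxWeights v).Finite := by
  refine ((Finset.Icc 1 (Fintype.card ι)).finite_toSet.biUnion (t := latticeWeights v)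
    fun h hh => finite_latticeWeights hv (Finset.mem_Icc.1 hh).1).subset ?_
  rintro b ⟨hb1, h, hb⟩
  exact Set.mem_biUnion (Finset.mem_coe.2 (Finset.mem_Icc.2 (height_bounds hb1 hb))) hb

theorem latticeCast_sum_natCast (v : ι → Fin n → ℤ) (a : ι → ℕ) :
    ∑ i, (a i : ℝ) • latticeCast (v i) = latticeCast (∑ i, a i • v i) := by
  ext j
  simp [latticeCast, Finset.sum_apply]

/-- Translation by integral weights decomposes the weights of total `k` along the box. -/
theorem latticeWeights_eq_iUnion (v : ι → Fin n → ℤ) (k : ℕ) :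
    latticeWeights v k = ⋃ b : boxWeights v, (fun (a : ι → ℕ) i => b.1 i + (a i : ℝ)) ''
      {a | ∑ i, a i + ⌊∑ i, b.1 i⌋₊ = k} := by
  ext w
  simp only [Set.mem_iUnion]
  constructor
  · rintro ⟨hw0, hw1, z, hz⟩
    have hc : ∀ i, 1 ≤ ⌈w i⌉₊ := fun i => Nat.one_le_ceil_iff.2 (hw0 i)
    have hcast : ∀ i, ((⌈w i⌉₊ - 1 : ℕ) : ℝ) = (⌈w i⌉₊ : ℝ) - 1 := fun i => by
      rw [Nat.cast_sub (hc i), Nat.cast_one]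
    have hb0 : ∀ i, 0 < w i - (⌈w i⌉₊ - 1 : ℕ) := fun i => by
      have := Nat.ceil_lt_add_one (hw0 i).le
      rw [hcast]
      linarith
    have hle : ∑ i, (⌈w i⌉₊ - 1) ≤ k := by
      have : ((∑ i, (⌈w i⌉₊ - 1) : ℕ) : ℝ) ≤ k := by
        rw [← hw1, Nat.cast_sum]
        exact Finset.sum_le_sum fun i _ => by linarith [hb0 i]
      exact_mod_cast this
    have hb : (fun i => w i - (⌈w i⌉₊ - 1 : ℕ)) ∈
        latticeWeights v (k - ∑ i, (⌈w i⌉₊ - 1)) := by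
      refine ⟨hb0, ?_, z - ∑ i, (⌈w i⌉₊ - 1) • v i, ?_⟩
      · rw [Finset.sum_sub_distrib, hw1, Nat.cast_sub hle, Nat.cast_sum]
      · simp only [sub_smul, Finset.sum_sub_distrib, hz, latticeCast_sum_natCast]
        ext j
        simp [latticeCast]
    refine ⟨⟨_, fun i => ?_, _, hb⟩, fun i => ⌈w i⌉₊ - 1, ?_, ?_⟩
    · have := Nat.le_ceil (w i)
      rw [hcast]
      linarith
    · simp only [Set.mem_ofPred_eq]
      rw [floor_sum_of_mem_latticeWeights hb]
      omega
    · ext i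
      simp
  · rintro ⟨⟨b, hb1, h, hb⟩, a, ha, rfl⟩
    simp only [Set.mem_ofPred_eq] at ha
    rw [floor_sum_of_mem_latticeWeights hb] at ha
    obtain ⟨z, hz⟩ := hb.2.2
    refine ⟨fun i => add_pos_of_pos_of_nonneg (hb.1 i) (Nat.cast_nonneg _), ?_,
      z + ∑ i, a i • v i, ?_⟩
    · simp only [Finset.sum_add_distrib, hb.2.1, ← ha]
      push_cast
      ring
    · simp only [add_smul, Finset.sum_add_distrib, hz, latticeCast_sum_natCast]
      ext j
      simp [latticeCast]

theorem eq_of_add_natCast_eq {a b : ℝ} {m l : ℕ} (ha0 : 0 < a) (ha1 : a ≤ 1) (hb0 : 0 < b)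
    (hb1 : b ≤ 1) (h : a + m = b + l) : a = b := by
  have h1 : (m : ℝ) < l + 1 := by linarith
  have h2 : (l : ℝ) < m + 1 := by linarith
  have h3 : m = l := by
    norm_cast at h1 h2
    omega
  subst h3
  linarith

theorem ncard_setOf_sum_add_eq [Nonempty ι] {h k : ℕ} (hk : 1 ≤ k) (h1 : 1 ≤ h)
    (hc : h ≤ Fintype.card ι) :
    {a : ι → ℕ | ∑ i, a i + h = k}.ncard =
      (k - 1 + (Fintype.card ι - h)).choose (Fintype.card ι - 1) := by
  classical
  rcases lt_or_ge k h with hlt | hle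
  · rw [Nat.choose_eq_zero_of_lt (by omega)]
    convert Set.ncard_empty (ι → ℕ)
    ext a
    simp only [Set.mem_ofPred_eq, Set.mem_empty_iff_false, iff_false]
    omega
  · have hset : {a : ι → ℕ | ∑ i, a i + h = k} =
        (Finset.piAntidiag (Finset.univ : Finset ι) (k - h) : Set (ι → ℕ)) := by
      ext a
      simp only [Set.mem_ofPred_eq, Finset.mem_coe, Finset.mem_piAntidiag, Finset.mem_univ,
        implies_true, and_true]
      change ∑ i, a i + h = k ↔ ∑ i, a i = k - h
      omega
    have hcard := Finset.card_finsuppAntidiag_nat_eq_choose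
      (s := (Finset.univ : Finset ι)) (k - h)
    rw [Finset.finsuppAntidiag, Finset.card_map, Finset.card_attach, Finset.card_univ] at hcard
    rw [hset, Set.ncard_coe_finset, hcard]
    have e : Fintype.card ι + (k - h) - 1 = (k - h) + (Fintype.card ι - 1) := by omega
    rw [e, Nat.choose_symm_add]
    congr 1
    omega

/-- The number of lattice points in the dilates of a relatively open lattice simplex. -/
theorem ncard_latticePoints_simplex [Nonempty ι] {v : ι → Fin n → ℤ}
    (hv : AffineIndependent ℝ fun i => latticeCast (v i)) {k : ℕ} (hk : 1 ≤ k) :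
    (latticePoints (posHull fun i => latticeCast (v i)) k).ncard =
      ∑ᶠ b : boxWeights v,
        (k - 1 + (Fintype.card ι - ⌊∑ i, b.1 i⌋₊)).choose (Fintype.card ι - 1) := by
  have := (finite_boxWeights hv).to_subtype
  rw [ncard_latticePoints_eq_ncard_latticeWeights hv hk, latticeWeights_eq_iUnion,
    Set.ncard_iUnion_of_finite]
  · refine finsum_congr fun b => ?_
    obtain ⟨b, hb1, h, hb⟩ := b
    obtain ⟨h1, hc⟩ := height_bounds hb1 hb
    rw [Set.ncard_image_of_injective, floor_sum_of_mem_latticeWeights hb,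
      ncard_setOf_sum_add_eq hk h1 hc]
    intro a a' haa
    ext i
    simpa using congrFun haa i
  · intro b
    refine (finite_latticeWeights hv hk).subset ?_
    rw [latticeWeights_eq_iUnion]
    exact Set.subset_iUnion (fun b : boxWeights v => (fun (a : ι → ℕ) i => b.1 i + (a i : ℝ)) ''
      {a | ∑ i, a i + ⌊∑ i, b.1 i⌋₊ = k}) b
  · intro b b' hne
    rw [Function.onFun, Set.disjoint_left]
    rintro _ ⟨a, -, rfl⟩ ⟨a', -, haa⟩
    obtain ⟨b, hb1, h, hb⟩ := b
    obtain ⟨b', hb1', h', hb'⟩ := b'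
    refine hne (Subtype.ext (funext fun i => ?_))
    exact (eq_of_add_natCast_eq (hb'.1 i) (hb1' i) (hb.1 i) (hb1 i) (congrFun haa i)).symm

end LatticeCount

section FStar

variable {n d : ℕ}

/-- The counting function `g` is, for positive arguments `k`, a combination of the binomial
coefficients `binomial (k-1) i`, `i ≤ d`, with coefficients in `ℕ`. -/
def HasNatFStar (d : ℕ) (g : ℕ → ℕ) : Prop :=
  ∃ m : ℕ → ℕ, ∀ k, 1 ≤ k → g k = ∑ i ∈ Finset.range (d + 1), m i * (k - 1).choose i

theorem HasNatFStar.congr {g g' : ℕ → ℕ} (hg : HasNatFStar d g)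
    (h : ∀ k, 1 ≤ k → g' k = g k) : HasNatFStar d g' := by
  obtain ⟨m, hm⟩ := hg
  exact ⟨m, fun k hk => (h k hk).trans (hm k hk)⟩

theorem HasNatFStar.sum {α : Type*} (s : Finset α) {g : α → ℕ → ℕ}
    (hg : ∀ x, HasNatFStar d (g x)) : HasNatFStar d fun k => ∑ x ∈ s, g x k := by
  choose m hm using hg
  refine ⟨fun i => ∑ x ∈ s, m x i, fun k hk => ?_⟩
  simp_rw [Finset.sum_mul]
  rw [Finset.sum_comm]
  exact Finset.sum_congr rfl fun x _ => hm x k hk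

theorem hasNatFStar_choose {r c : ℕ} (hc : c ≤ d) :
    HasNatFStar d fun k => (k - 1 + r).choose c := by
  refine ⟨fun i => if i ≤ c then r.choose (c - i) else 0, fun k _ => ?_⟩
  beta_reduce
  rw [Nat.add_choose_eq, Finset.Nat.sum_antidiagonal_eq_sum_range_succ_mk,
    ← Finset.sum_subset (Finset.range_mono (Nat.succ_le_succ hc))]
  · refine Finset.sum_congr rfl fun i hi => ?_
    rw [if_pos (Nat.lt_succ_iff.1 (Finset.mem_range.1 hi)), mul_comm]
  · intro i _ hi
    rw [if_neg fun h => hi (Finset.mem_range.2 (Nat.lt_succ_iff.2 h)), zero_mul]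

theorem hasNatFStar_simplex {ι : Type*} [Fintype ι] [Nonempty ι] {v : ι → Fin n → ℤ}
    (hv : AffineIndependent ℝ fun i => latticeCast (v i)) (hd : Fintype.card ι ≤ d + 1) :
    HasNatFStar d fun k => (latticePoints (posHull fun i => latticeCast (v i)) k).ncard := by
  have := (finite_boxWeights hv).fintype
  refine (HasNatFStar.sum (Finset.univ : Finset (boxWeights v)) fun b =>
    hasNatFStar_choose (r := Fintype.card ι - ⌊∑ i, b.1 i⌋₊) (c := Fintype.card ι - 1)
      (by omega)).congr fun k hk => ?_
  rw [ncard_latticePoints_simplex hv hk, finsum_eq_sum_of_fintype]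

theorem ncard_latticePoints_iUnion {α : Type*} [Fintype α] {A : α → Set (Fin n → ℝ)} {k : ℕ}
    (hk : 1 ≤ k) (hfin : ∀ x, (latticePoints (A x) k).Finite)
    (hdisj : ∀ x y, x ≠ y → Disjoint (A x) (A y)) :
    (latticePoints (⋃ x, A x) k).ncard = ∑ x, (latticePoints (A x) k).ncard := by
  have hk0 : (k : ℝ) ≠ 0 := by positivity
  have h : latticePoints (⋃ x, A x) k = ⋃ x, latticePoints (A x) k := by
    ext z
    simp [latticePoints, Set.smul_set_iUnion]
  rw [h, Set.ncard_iUnion_of_finite hfin, finsum_eq_sum_of_fintype]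
  intro x y hxy
  rw [Function.onFun, Set.disjoint_left]
  intro z hx hy
  exact Set.disjoint_left.1 (hdisj x y hxy) ((Set.mem_smul_set_iff_inv_smul_mem₀ hk0 _ _).1 hx)
    ((Set.mem_smul_set_iff_inv_smul_mem₀ hk0 _ _).1 hy)

theorem hasNatFStar_posHull {ι : Type*} [Fintype ι] (v : ι → Fin n → ℤ)
    (hd : Module.finrank ℝ (vectorSpan ℝ (Set.range fun i => latticeCast (v i))) ≤ d) :
    HasNatFStar d fun k => (latticePoints (posHull fun i => latticeCast (v i)) k).ncard := by
  obtain ⟨T, hT, hdisj, hunion⟩ := exists_triangulation_posHull fun i => latticeCast (v i)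
  refine (HasNatFStar.sum (Finset.univ : Finset T)
    (g := fun S k => (latticePoints (posHull fun i : S.1 => latticeCast (v i)) k).ncard)
    fun S => ?_).congr fun k hk => ?_
  · obtain ⟨hne, hind⟩ := hT S.1 S.2
    have : Nonempty S.1 := hne.to_subtype
    refine hasNatFStar_simplex (v := fun i : S.1 => v i) hind ?_
    rw [← hind.finrank_vectorSpan_add_one]
    refine Nat.succ_le_succ ((Submodule.finrank_mono (vectorSpan_mono ℝ ?_)).trans hd)
    rintro _ ⟨i, rfl⟩
    exact ⟨i, rfl⟩
  · rw [hunion, ncard_latticePoints_iUnion hk]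
    · exact fun S => finite_latticePoints_posHull (fun i : S.1 => v i) hk
    · exact fun S S' h => hdisj S.1 S.2 S'.1 S'.2 fun h' => h (Subtype.ext h')

theorem openLatticePolytope_image {ι : Type*} [Fintype ι] (v : ι → Fin n → ℤ)
    {V : Finset (Fin n → ℤ)} (hV : (V : Set (Fin n → ℤ)) = Set.range v) :
    openLatticePolytope n V = posHull fun i => latticeCast (v i) := by
  rw [← intrinsicInterior_convexHull_range, openLatticePolytope, hV, ← Set.range_comp]
  rfl

theorem eval_binomDesc (i : ℕ) {k : ℕ} (hk : 1 ≤ k) :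
    (binomDesc i).eval (k : ℚ) = ((k - 1).choose i : ℚ) := by
  obtain ⟨m, rfl⟩ := Nat.exists_eq_add_of_le' hk
  have h : ∏ j ∈ Finset.range i, (((m + 1 : ℕ) : ℚ) - ((j : ℚ) + 1)) = m.descFactorial i := by
    rw [← descPochhammer_eval_eq_descFactorial ℚ m i, descPochhammer_eval_eq_prod_range]
    exact Finset.prod_congr rfl fun j _ => by push_cast; ring
  rw [binomDesc, eval_mul, eval_C, eval_prod]
  simp only [eval_sub, eval_X, eval_C]
  rw [h, Nat.add_sub_cancel, Nat.descFactorial_eq_factorial_mul_choose, Nat.cast_mul,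
    inv_mul_cancel_left₀ (by exact_mod_cast i.factorial_ne_zero)]

/-- The binomial coefficients `binomial (k-1) i` are linearly independent as functions of `k`. -/
theorem eq_of_sum_choose_eq {f g : ℕ → ℚ}
    (h : ∀ k, 1 ≤ k → ∑ i ∈ Finset.range (d + 1), f i * ((k - 1).choose i : ℚ) =
      ∑ i ∈ Finset.range (d + 1), g i * ((k - 1).choose i : ℚ)) :
    ∀ i, i ≤ d → f i = g i := by
  intro i
  induction i using Nat.strong_induction_on with
  | _ i ih =>
    intro hi
    have hs := h (i + 1) (by omega)
    rw [← sub_eq_zero, ← Finset.sum_sub_distrib, Finset.sum_eq_single i] at hs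
    · simpa [sub_eq_zero] using hs
    · intro j _ hj
      rcases lt_or_gt_of_ne hj with hlt | hgt
      · rw [ih j hlt (by omega), sub_self]
      · simp [Nat.choose_eq_zero_of_lt hgt]
    · intro hni
      exact absurd (Finset.mem_range.2 (by omega)) hni

/-- The vertices of a unimodular simplex of dimension `i`, at height `t`. -/
def unimodularVertex (i d : ℕ) (h : i ≤ d) (t : ℤ) (j : Fin (i + 1)) : Fin (d + 2) → ℤ :=
  Fin.cons t (Pi.single (Fin.castLE (Nat.succ_le_succ h) j) 1)

variable {i : ℕ} (h : i ≤ d) (t : ℤ)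

theorem sum_smul_unimodularVertex_zero (w : Fin (i + 1) → ℝ) :
    (∑ j, w j • latticeCast (unimodularVertex i d h t j)) 0 = (∑ j, w j) * t := by
  simp [latticeCast, unimodularVertex, Finset.sum_apply, Finset.sum_mul]

theorem sum_smul_unimodularVertex_succ (w : Fin (i + 1) → ℝ) (j : Fin (i + 1)) :
    (∑ j, w j • latticeCast (unimodularVertex i d h t j))
      (Fin.castLE (Nat.succ_le_succ h) j).succ = w j := by
  rw [Finset.sum_apply, Finset.sum_eq_single j]
  · simp [latticeCast, unimodularVertex]
  · intro l _ hl
    have : (Fin.castLE (Nat.succ_le_succ h) j) ≠ Fin.castLE (Nat.succ_le_succ h) l := fun e =>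
      hl (Fin.castLE_injective _ e).symm
    simp [latticeCast, unimodularVertex, Pi.single_eq_of_ne this]
  · simp

theorem affineIndependent_unimodularVertex :
    AffineIndependent ℝ fun j => latticeCast (unimodularVertex i d h t j) := by
  refine LinearIndependent.affineIndependent ℝ
    (Fintype.linearIndependent_iff.2 fun w hw j => ?_)
  rw [← sum_smul_unimodularVertex_succ h t w j, hw, Pi.zero_apply]

theorem boxWeights_unimodularVertex :
    boxWeights (unimodularVertex i d h t) = {fun _ => 1} := by
  ext b
  rw [Set.mem_singleton_iff]
  constructor
  · rintro ⟨hb1, l, hb0, -, z, hz⟩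
    ext j
    have hj := congrFun hz (Fin.castLE (Nat.succ_le_succ h) j).succ
    rw [sum_smul_unimodularVertex_succ] at hj
    have h0 := hb0 j
    have h1 := hb1 j
    rw [hj] at h0 h1 ⊢
    simp only [latticeCast] at h0 h1 ⊢
    norm_cast at h0 h1 ⊢
    omega
  · rintro rfl
    refine ⟨fun _ => le_rfl, i + 1, fun _ => one_pos, by simp,
      ∑ j, unimodularVertex i d h t j, ?_⟩
    have := latticeCast_sum_natCast (unimodularVertex i d h t) 1
    simpa using this

theorem ncard_latticePoints_unimodular {k : ℕ} (hk : 1 ≤ k) :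
    (latticePoints (posHull fun j => latticeCast (unimodularVertex i d h t j)) k).ncard =
      (k - 1).choose i := by
  rw [ncard_latticePoints_simplex (affineIndependent_unimodularVertex h t) hk,
    finsum_set_coe_eq_finsum_mem (f := fun b : Fin (i + 1) → ℝ =>
      (k - 1 + (Fintype.card (Fin (i + 1)) - ⌊∑ j, b j⌋₊)).choose (Fintype.card (Fin (i + 1)) - 1)),
    boxWeights_unimodularVertex, finsum_mem_singleton]
  have hfl : ⌊(i : ℝ) + 1⌋₊ = i + 1 := by exact_mod_cast Nat.floor_natCast (R := ℝ) (i + 1)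
  simp [hfl]

end FStar

/-- Characterization of `f*`-vectors: a vector `(f 0, …, f d)` is the `f*`-vector of
some integral partial polytopal complex (a finite disjoint union of relatively open
lattice polytopes of dimension at most `d`) if and only if all its entries are
non-negative integers. -/
theorem fstar_characterization (d : ℕ) (f : ℕ → ℚ) :
    (∃ (n N : ℕ) (V : Fin N → Finset (Fin n → ℤ)),
      (∀ t, Module.finrank ℝ
        (vectorSpan ℝ ((fun z : Fin n → ℤ => fun j => ((z j : ℝ))) '' (V t))) ≤ d) ∧
      (∀ s t, s ≠ t →
        Disjoint (openLatticePolytope n (V s)) (openLatticePolytope n (V t))) ∧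
      ∀ k : ℕ, 1 ≤ k →
        (Set.ncard {z : Fin n → ℤ |
            ((fun j => ((z j : ℝ))) : Fin n → ℝ) ∈
              ((k : ℝ) • (⋃ t, openLatticePolytope n (V t)) : Set (Fin n → ℝ))} : ℚ) =
          ∑ i ∈ Finset.range (d + 1), f i * (binomDesc i).eval (k : ℚ)) ↔
    (∀ i, i ≤ d → ∃ m : ℕ, f i = (m : ℚ)) := by
  have hpoly : ∀ {n : ℕ} (V : Finset (Fin n → ℤ)),
      openLatticePolytope n V = posHull fun z : V => latticeCast z.1 := fun V =>
    openLatticePolytope_image (fun z : V => z.1) (by simp)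
  constructor
  · rintro ⟨n, N, V, hdim, hdisj, hcount⟩
    have hfs : HasNatFStar d fun k =>
        (latticePoints (⋃ t, openLatticePolytope n (V t)) k).ncard := by
      refine (HasNatFStar.sum (Finset.univ : Finset (Fin N))
        (g := fun t k => (latticePoints (openLatticePolytope n (V t)) k).ncard)
        fun t => ?_).congr fun k hk => ncard_latticePoints_iUnion hk (fun t => ?_) hdisj
      · rw [hpoly]
        refine hasNatFStar_posHull (fun z : V t => z.1) ?_
        have := hdim t
        rwa [Set.image_eq_range] at this
      · rw [hpoly]
        exact finite_latticePoints_posHull (fun z : V t => z.1) hk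
    obtain ⟨m, hm⟩ := hfs
    refine fun i hi => ⟨m i, eq_of_sum_choose_eq (d := d) (g := fun i => (m i : ℚ))
      (fun k hk => ?_) i hi⟩
    have h1 := hcount k hk
    have h2 : (latticePoints (⋃ t, openLatticePolytope n (V t)) k).ncard = _ := hm k hk
    rw [show {z : Fin n → ℤ | ((fun j => ((z j : ℝ))) : Fin n → ℝ) ∈
      ((k : ℝ) • (⋃ t, openLatticePolytope n (V t)) : Set (Fin n → ℝ))} =
      latticePoints (⋃ t, openLatticePolytope n (V t)) k from rfl, h2] at h1
    simp_rw [eval_binomDesc _ hk] at h1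
    rw [← h1]
    push_cast
    rfl
  · intro hf
    choose m hm using fun i : Fin (d + 1) => hf i (Nat.lt_succ_iff.1 i.2)
    -- one unimodular simplex, in its own parallel hyperplane, for each unit of each entry
    let e := (Fintype.equivFin (Σ i : Fin (d + 1), Fin (m i))).symm
    have hle : ∀ t, ((e t).1 : ℕ) ≤ d := fun t => Nat.lt_succ_iff.1 (e t).1.2
    let u := fun t => unimodularVertex (e t).1 d (hle t) (t : ℕ)
    have hu : ∀ t, openLatticePolytope (d + 2) (Finset.univ.image (u t)) =
        posHull fun j => latticeCast (u t j) := fun t => openLatticePolytope_image (u t) (by simp)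
    have hdisj : ∀ s t, s ≠ t → Disjoint (posHull fun j => latticeCast (u s j))
        (posHull fun j => latticeCast (u t j)) := fun s t hst => by
      rw [Set.disjoint_left]
      rintro _ ⟨w, -, hw, rfl⟩ ⟨w', -, hw', h⟩
      have h0 := congrFun h 0
      rw [sum_smul_unimodularVertex_zero, sum_smul_unimodularVertex_zero, hw, hw', one_mul,
        one_mul] at h0
      exact hst (Fin.ext (by exact_mod_cast h0.symm))
    refine ⟨d + 2, _, fun t => Finset.univ.image (u t), fun t => ?_, fun s t hst => ?_,
      fun k hk => ?_⟩
    · refine le_trans ?_ (hle t)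
      rw [Finset.coe_image, Finset.coe_univ, Set.image_univ, ← Set.range_comp]
      exact finrank_vectorSpan_range_le ℝ _ (by simp)
    · rw [hu, hu]
      exact hdisj s t hst
    · simp_rw [hu, eval_binomDesc _ hk]
      have hcount := ncard_latticePoints_iUnion hk
        (fun t => finite_latticePoints_posHull (u t) hk) hdisj
      refine (congrArg (Nat.cast (R := ℚ)) hcount).trans ?_
      have hterm : ∀ t, (latticePoints (posHull fun j => latticeCast (u t j)) k).ncard =
          (k - 1).choose (e t).1 := fun t => ncard_latticePoints_unimodular (hle t) _ hk
      simp_rw [hterm]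
      rw [e.sum_comp fun p => (k - 1).choose p.1, Fintype.sum_sigma, Finset.sum_range]
      simp [hm]
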